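/- arXiv:hep-th/9407083 — 2 statements merged into one kernel-verified Lean document; each statement's English description precedes it below -/
import Mathlib

section
/- The bilinear form q on M is invariant with respect to the multiplication: q(a·b, c) = q(a, b·c) for all a, b, c ∈ M; hence the induced form on the quotient algebra A = M/I makes A a metrised algebra. -/
open scoped TensorProduct DirectSum

noncomputable section

/-- The pure tensor `a₀ ⊗ a₁ ⊗ ⋯ ⊗ a_{m-1}` in the `m`-th tensor power. -/
def tp (A : Type) [AddCommGroup A] [Module ℂ A] (m : ℕ) (a : ℕ → A) : ⨂[ℂ]^m A :=
  PiTensorProduct.tprod ℂ (fun i : Fin m => a i.1)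

/-- The space `M = ⊕_{k=1}^{p} A₁^{⊗k}`; the component of index `k : Fin p` is the
tensor power of degree `k + 1`. -/
abbrev Mspace (p : ℕ) (A : Type) [AddCommGroup A] [Module ℂ A] : Type :=
  ⨁ k : Fin p, ⨂[ℂ]^(k.1 + 1) A

/-- Inclusion of the degree-`(k+1)` homogeneous component into `M`. -/
def incl (p : ℕ) (A : Type) [AddCommGroup A] [Module ℂ A] (k : Fin p) :
    (⨂[ℂ]^(k.1 + 1) A) →ₗ[ℂ] Mspace p A :=
  DirectSum.lof ℂ (Fin p) (fun k : Fin p => ⨂[ℂ]^(k.1 + 1) A) k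

/-- The one-step substitution `id^{⊗r} ⊗ Γ ⊗ id^{⊗(n-2-r)}` followed by `Γ`, evaluated on
a family of `2n−3` arguments; used to state the general associativity condition. -/
def gammaIns (n : ℕ) (A : Type) [AddCommGroup A] [Module ℂ A]
    (Γ : MultilinearMap ℂ (fun _ : Fin (n - 1) => A) A) (r : ℕ) (a : ℕ → A) : A :=
  Γ (fun i : Fin (n - 1) =>
    if i.1 < r then a i.1
    else if i.1 = r then Γ (fun j : Fin (n - 1) => a (r + j.1))
    else a (i.1 + (n - 2)))

/-- `mul` is the bilinear multiplication of `M = ⊕_{k=1}^{p} A₁^{⊗k}` determined on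
homogeneous pure tensors `a = a₁⊗⋯⊗a_k`, `b = b₁⊗⋯⊗b_l` by: `a·b = a ⊗ b` if
`k + l ≤ p`, and `a·b = Γ(a₁,…,a_k,b₁,…,b_{p+1−k}) ⊗ b_{p+2−k} ⊗ ⋯ ⊗ b_l` if
`k + l > p`. -/
def MulSpec (n p : ℕ) (A : Type) [AddCommGroup A] [Module ℂ A]
    (Γ : MultilinearMap ℂ (fun _ : Fin (n - 1) => A) A)
    (mul : Mspace p A →ₗ[ℂ] Mspace p A →ₗ[ℂ] Mspace p A) : Prop :=
  ∀ (k l : Fin p) (a b : ℕ → A),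
    mul (incl p A k (tp A (k.1 + 1) a)) (incl p A l (tp A (l.1 + 1) b)) =
      if h : (k.1 + 1) + (l.1 + 1) ≤ p then
        incl p A ⟨k.1 + l.1 + 1, by omega⟩
          (tp A (k.1 + l.1 + 1 + 1)
            (fun i => if i < k.1 + 1 then a i else b (i - (k.1 + 1))))
      else
        incl p A ⟨k.1 + l.1 + 1 - p, by have := k.isLt; have := l.isLt; omega⟩
          (tp A (k.1 + l.1 + 1 - p + 1)
            (fun i =>
              if i = 0 then
                Γ (fun j : Fin (n - 1) =>
                  if j.1 < k.1 + 1 then a j.1 else b (j.1 - (k.1 + 1)))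
              else b (p - (k.1 + 1) + i)))

/-- The subspace `I_k ⊆ A₁^{⊗k}`: `I₁ = {0}`, and for `2 ≤ k ≤ p`,
`I_k = {a : a·b = 0 for all b ∈ A₁^{⊗(p+1−k)}}`.  (The component of index `k : Fin p`
has degree `k + 1`.) -/
def Ik (p : ℕ) (A : Type) [AddCommGroup A] [Module ℂ A]
    (mul : Mspace p A →ₗ[ℂ] Mspace p A →ₗ[ℂ] Mspace p A) (k : Fin p) :
    Submodule ℂ (⨂[ℂ]^(k.1 + 1) A) :=
  if k.1 = 0 then ⊥
  else
    ⨅ y : ⨂[ℂ]^(p - (k.1 + 1) + 1) A,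
      LinearMap.ker
        ((mul.flip (incl p A ⟨p - (k.1 + 1), by have := k.isLt; omega⟩ y)).comp (incl p A k))

/-- The subspace `I = ⊕_{k=1}^{p} I_k ⊆ M`. -/
def Isub (p : ℕ) (A : Type) [AddCommGroup A] [Module ℂ A]
    (mul : Mspace p A →ₗ[ℂ] Mspace p A →ₗ[ℂ] Mspace p A) : Submodule ℂ (Mspace p A) :=
  ⨆ k : Fin p, (Ik p A mul k).map (incl p A k)

/-- `qM` is the bilinear form on `M` determined on homogeneous pure tensors
`a ∈ A₁^{⊗k}`, `b ∈ A₁^{⊗l}` by: `q(a,b) = 0` if `k + l ≢ 2 mod p`;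
`q(a,b) = q₁(a₁, Γ(a₂,…,a_k,b₁,…,b_l))` if `k + l = n`; and `q(a,b) = q₁(a₁,b₁)` if
`k = l = 1`. -/
def QSpec (n p : ℕ) (A : Type) [AddCommGroup A] [Module ℂ A]
    (Γ : MultilinearMap ℂ (fun _ : Fin (n - 1) => A) A)
    (q₁ : A →ₗ[ℂ] A →ₗ[ℂ] ℂ)
    (qM : Mspace p A →ₗ[ℂ] Mspace p A →ₗ[ℂ] ℂ) : Prop :=
  ∀ (k l : Fin p) (a b : ℕ → A),
    qM (incl p A k (tp A (k.1 + 1) a)) (incl p A l (tp A (l.1 + 1) b)) =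
      if ((k.1 + 1) + (l.1 + 1)) % p = 2 % p then
        (if (k.1 + 1) + (l.1 + 1) = n then
          q₁ (a 0) (Γ (fun j : Fin (n - 1) =>
            if j.1 + 1 < k.1 + 1 then a (j.1 + 1) else b (j.1 + 1 - (k.1 + 1))))
        else q₁ (a 0) (b 0))
      else 0


lemma hom_ext_tp {p : ℕ} {A : Type} [AddCommGroup A] [Module ℂ A] {N : Type} [AddCommGroup N]
    [Module ℂ N] (f g : Mspace p A →ₗ[ℂ] N)
    (h : ∀ (i : ℕ) (hi : i < p) (a : ℕ → A),
      f (incl p A ⟨i, hi⟩ (tp A (i + 1) a)) = g (incl p A ⟨i, hi⟩ (tp A (i + 1) a))) : f = g := by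
  apply DirectSum.linearMap_ext
  intro k
  apply PiTensorProduct.ext
  ext a
  have := h k.1 k.2 (fun i => if h : i < k.1 + 1 then a ⟨i, h⟩ else 0)
  have e : tp A (k.1 + 1) (fun i => if h : i < k.1 + 1 then a ⟨i, h⟩ else 0)
      = PiTensorProduct.tprod ℂ a := by
    unfold tp
    congr 1
    funext i
    exact dif_pos i.2
  rw [e] at this
  exact this

section
variable {n p : ℕ} {A : Type} [AddCommGroup A] [Module ℂ A]
    {Γ : MultilinearMap ℂ (fun _ : Fin (n - 1) => A) A}
    {q₁ : A →ₗ[ℂ] A →ₗ[ℂ] ℂ}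
    {mul : Mspace p A →ₗ[ℂ] Mspace p A →ₗ[ℂ] Mspace p A}
    {qM : Mspace p A →ₗ[ℂ] Mspace p A →ₗ[ℂ] ℂ}

lemma qM_n (hqM : QSpec n p A Γ q₁ qM) (hn : n = p + 2) {i j : ℕ} (hi : i < p) (hj : j < p)
    (a b : ℕ → A) (h : i + j = p) :
    qM (incl p A ⟨i, hi⟩ (tp A (i + 1) a)) (incl p A ⟨j, hj⟩ (tp A (j + 1) b)) =
      q₁ (a 0) (Γ (fun t => if t.1 < i then a (t.1 + 1) else b (t.1 - i))) := by
  refine (hqM ⟨i, hi⟩ ⟨j, hj⟩ a b).trans ?_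
  have h1 : (i + 1) + (j + 1) = p + 2 := by omega
  have h2 : (p + 2) % p = 2 % p := by simp
  simp only [h1, h2, hn, if_true, Nat.add_lt_add_iff_right, Nat.add_sub_add_right]

lemma qM_1 (hqM : QSpec n p A Γ q₁ qM) (hn : n = p + 2) {i j : ℕ} (hi : i < p) (hj : j < p)
    (a b : ℕ → A) (h : i + j = 0) :
    qM (incl p A ⟨i, hi⟩ (tp A (i + 1) a)) (incl p A ⟨j, hj⟩ (tp A (j + 1) b)) =
      q₁ (a 0) (b 0) := by
  refine (hqM ⟨i, hi⟩ ⟨j, hj⟩ a b).trans ?_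
  have h1 : (i + 1) + (j + 1) = 2 := by omega
  have h3 : ¬ (2 = n) := by omega
  simp only [h1, if_true, h3, if_false]

lemma qM_0 (hqM : QSpec n p A Γ q₁ qM) {i j : ℕ} (hi : i < p) (hj : j < p)
    (a b : ℕ → A) (h : i + j ≠ 0) (h' : i + j ≠ p) :
    qM (incl p A ⟨i, hi⟩ (tp A (i + 1) a)) (incl p A ⟨j, hj⟩ (tp A (j + 1) b)) = 0 := by
  refine (hqM ⟨i, hi⟩ ⟨j, hj⟩ a b).trans ?_
  have h1 : ¬ (((i + 1) + (j + 1)) % p = 2 % p) := by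
    intro e
    have e' : 2 + 0 ≡ 2 + (i + j) [MOD p] := by
      unfold Nat.ModEq
      rw [show 2 + (i + j) = i + 1 + (j + 1) by ring, e]
    have := (Nat.modEq_iff_dvd' (Nat.zero_le _)).1 (Nat.ModEq.add_left_cancel' 2 e')
    obtain ⟨c, hc⟩ := this
    rcases c with _ | _ | c
    · omega
    · omega
    · have : p * (c + 1 + 1) = p * c + 2 * p := by ring
      have : 0 ≤ p * c := Nat.zero_le _
      omega
  simp only [h1, if_false]

lemma mul_low (hmul : MulSpec n p A Γ mul) {i j : ℕ} (hi : i < p) (hj : j < p)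
    (a b : ℕ → A) (h : i + j + 1 < p) :
    mul (incl p A ⟨i, hi⟩ (tp A (i + 1) a)) (incl p A ⟨j, hj⟩ (tp A (j + 1) b)) =
      incl p A ⟨i + j + 1, h⟩ (tp A (i + j + 1 + 1)
        (fun t => if t < i + 1 then a t else b (t - (i + 1)))) := by
  refine (hmul ⟨i, hi⟩ ⟨j, hj⟩ a b).trans ?_
  rw [dif_pos (show (i + 1) + (j + 1) ≤ p by omega)]

lemma mul_high (hmul : MulSpec n p A Γ mul) {i j : ℕ} (hi : i < p) (hj : j < p)
    (a b : ℕ → A) (h : ¬ i + j + 1 < p) :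
    mul (incl p A ⟨i, hi⟩ (tp A (i + 1) a)) (incl p A ⟨j, hj⟩ (tp A (j + 1) b)) =
      incl p A ⟨i + j + 1 - p, by omega⟩ (tp A (i + j + 1 - p + 1)
        (fun t => if t = 0 then
            Γ (fun s => if s.1 < i + 1 then a s.1 else b (s.1 - (i + 1)))
          else b (p - (i + 1) + t))) := by
  refine (hmul ⟨i, hi⟩ ⟨j, hj⟩ a b).trans ?_
  rw [dif_neg (show ¬ (i + 1) + (j + 1) ≤ p by omega)]

/-- concatenation of three words -/
def cat3 (i j : ℕ) (a b c : ℕ → A) (t : ℕ) : A :=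
  if t < i + 1 then a t else if t < i + 1 + (j + 1) then b (t - (i + 1))
    else c (t - (i + 1) - (j + 1))

lemma inv_hom (hn : n = p + 2)
    (hinv : ∀ a : ℕ → A,
      q₁ (Γ (fun i : Fin (n - 1) => a i.1)) (a (n - 1)) =
        q₁ (a 0) (Γ (fun i : Fin (n - 1) => a (i.1 + 1))))
    (hassoc : ∀ r s : ℕ, r ≤ n - 2 → s ≤ n - 2 → ∀ a : ℕ → A,
      gammaIns n A Γ r a = gammaIns n A Γ s a)
    (hmul : MulSpec n p A Γ mul) (hqM : QSpec n p A Γ q₁ qM)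
    {i j k : ℕ} (hi : i < p) (hj : j < p) (hk : k < p) (a b c : ℕ → A) :
    qM (mul (incl p A ⟨i, hi⟩ (tp A (i + 1) a)) (incl p A ⟨j, hj⟩ (tp A (j + 1) b)))
      (incl p A ⟨k, hk⟩ (tp A (k + 1) c)) =
    qM (incl p A ⟨i, hi⟩ (tp A (i + 1) a))
      (mul (incl p A ⟨j, hj⟩ (tp A (j + 1) b)) (incl p A ⟨k, hk⟩ (tp A (k + 1) c))) := by
  by_cases h1 : i + j + k + 1 = p
  · -- total degree p + 2
    trans q₁ (cat3 i j a b c 0) (Γ (fun t => cat3 i j a b c (t.1 + 1)))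
    · by_cases h2 : i + j + 1 < p
      · rw [mul_low hmul hi hj a b h2, qM_n hqM hn _ _ _ _ (by omega)]
        congr 2
        funext t
        have := t.2
        unfold cat3
        split_ifs <;> first | omega | (congr 1 <;> omega)
      · rw [mul_high hmul hi hj a b h2, qM_1 hqM hn _ _ _ _ (by omega), ← hinv]
        have e : c 0 = cat3 i j a b c (n - 1) := by
          unfold cat3
          split_ifs <;> first | omega | (congr 1 <;> omega)
        rw [e, if_pos rfl]
        congr 3
        funext t
        have := t.2
        unfold cat3
        split_ifs <;> first | omega | (congr 1 <;> omega)
    · have e0 : cat3 i j a b c 0 = a 0 := by simp [cat3]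
      rw [e0]
      by_cases h2 : j + k + 1 < p
      · rw [mul_low hmul hj hk b c h2, qM_n hqM hn _ _ _ _ (by omega)]
        congr 2
        funext t
        have := t.2
        unfold cat3
        split_ifs <;> first | omega | (congr 1 <;> omega)
      · rw [mul_high hmul hj hk b c h2, qM_1 hqM hn _ _ _ _ (by omega), if_pos rfl]
        congr 2
        funext t
        have := t.2
        unfold cat3
        split_ifs <;> first | omega | (congr 1 <;> omega)
  by_cases h3 : i + j + k + 1 = 2 * p
  · -- total degree 2 p + 2
    have hA := hassoc p i (by omega) (by omega) (fun t => cat3 i j a b c (t + 1))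
    rw [mul_high hmul hi hj a b (by omega), mul_high hmul hj hk b c (by omega),
      qM_n hqM hn _ _ _ _ (by omega), qM_n hqM hn _ _ _ _ (by omega), if_pos rfl]
    trans q₁ (cat3 i j a b c 0) (gammaIns n A Γ p (fun t => cat3 i j a b c (t + 1)))
    · have hI := hinv (fun t => if t < p + 1 then cat3 i j a b c t else
        Γ (fun s => cat3 i j a b c (p + s.1 + 1)))
      have hnn : n - 1 = p + 1 := by omega
      simp only [hnn, lt_irrefl, if_false, Nat.succ_pos, if_true] at hI
      refine Eq.trans ?_ (hI.trans ?_)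
      · congr 1
        · congr 2
          funext t
          have := t.2
          unfold cat3
          split_ifs <;> first | omega | (congr 1 <;> omega)
        · congr 1
          funext t
          have := t.2
          unfold cat3
          rw [if_neg (Nat.succ_ne_zero _), if_neg (show ¬ p + t.1 + 1 < i + 1 by omega)]
          by_cases ht : t.1 < i + j + 1 - p
          · rw [if_pos ht, if_pos (by omega),
              show p - (i + 1) + (t.1 + 1) = p + t.1 + 1 - (i + 1) by omega]
          · rw [if_neg ht, if_neg (by omega),
              show t.1 - (i + j + 1 - p) = p + t.1 + 1 - (i + 1) - (j + 1) by omega]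
      · congr 1
        unfold gammaIns
        congr 1
        funext t
        have := t.2
        by_cases ht : t.1 < p
        · simp [ht]
        · have : t.1 = p := by omega
          simp [this]
    · rw [hA]
      have e0 : cat3 i j a b c 0 = a 0 := by simp [cat3]
      rw [e0]
      congr 1
      unfold gammaIns
      congr 1
      funext t
      have := t.2
      rcases lt_trichotomy t.1 i with ht | ht | ht
      · simp [ht, cat3]
      · simp only [ht, lt_irrefl, if_false, if_true, Nat.sub_self]
        congr 1
        funext s
        have := s.2
        unfold cat3
        split_ifs <;> first | omega | (congr 1 <;> omega)
      · rw [if_neg (by omega), if_neg (by omega), if_neg (by omega), if_neg (by omega)]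
        simp only [cat3]
        split_ifs <;> first | omega | (congr 1 <;> omega)
  · trans 0
    · by_cases h2 : i + j + 1 < p
      · rw [mul_low hmul hi hj a b h2]
        exact qM_0 hqM _ _ _ _ (by omega) (by omega)
      · rw [mul_high hmul hi hj a b h2]
        exact qM_0 hqM _ _ _ _ (by omega) (by omega)
    · symm
      by_cases h2 : j + k + 1 < p
      · rw [mul_low hmul hj hk b c h2]
        exact qM_0 hqM _ _ _ _ (by omega) (by omega)
      · rw [mul_high hmul hj hk b c h2]
        exact qM_0 hqM _ _ _ _ (by omega) (by omega)

lemma inv_all (hn : n = p + 2)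
    (hinv : ∀ a : ℕ → A,
      q₁ (Γ (fun i : Fin (n - 1) => a i.1)) (a (n - 1)) =
        q₁ (a 0) (Γ (fun i : Fin (n - 1) => a (i.1 + 1))))
    (hassoc : ∀ r s : ℕ, r ≤ n - 2 → s ≤ n - 2 → ∀ a : ℕ → A,
      gammaIns n A Γ r a = gammaIns n A Γ s a)
    (hmul : MulSpec n p A Γ mul) (hqM : QSpec n p A Γ q₁ qM) (x y z : Mspace p A) :
    qM (mul x y) z = qM x (mul y z) := by
  have e1 : ∀ (i : ℕ) (hi : i < p) (a : ℕ → A) (j : ℕ) (hj : j < p) (b : ℕ → A),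
      qM (mul (incl p A ⟨i, hi⟩ (tp A (i + 1) a)) (incl p A ⟨j, hj⟩ (tp A (j + 1) b))) =
      (qM (incl p A ⟨i, hi⟩ (tp A (i + 1) a))).comp
        (mul (incl p A ⟨j, hj⟩ (tp A (j + 1) b))) := by
    intro i hi a j hj b
    apply hom_ext_tp
    intro k hk c
    exact inv_hom hn hinv hassoc hmul hqM hi hj hk a b c
  have e2 : ∀ (i : ℕ) (hi : i < p) (a : ℕ → A),
      (qM.comp (mul (incl p A ⟨i, hi⟩ (tp A (i + 1) a)))).flip z =
      (qM (incl p A ⟨i, hi⟩ (tp A (i + 1) a))).comp (mul.flip z) := by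
    intro i hi a
    apply hom_ext_tp
    intro j hj b
    exact LinearMap.congr_fun (e1 i hi a j hj b) z
  have e3 : (qM.flip z).comp (mul.flip y) = qM.flip (mul y z) := by
    apply hom_ext_tp
    intro i hi a
    exact LinearMap.congr_fun (e2 i hi a) y
  exact LinearMap.congr_fun e3 x

/-- cyclic invariance, iterated -/
lemma cyc (hn : n = p + 2) (hq₁symm : ∀ x y : A, q₁ x y = q₁ y x)
    (hinv : ∀ a : ℕ → A,
      q₁ (Γ (fun i : Fin (n - 1) => a i.1)) (a (n - 1)) =
        q₁ (a 0) (Γ (fun i : Fin (n - 1) => a (i.1 + 1)))) (w : ℕ → A)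
    (hw : ∀ t, w (t + n) = w t) (m : ℕ) :
    q₁ (w 0) (Γ (fun t => w (t.1 + 1))) = q₁ (w m) (Γ (fun t => w (m + t.1 + 1))) := by
  induction m with
  | zero => simp
  | succ m ih =>
    rw [ih]
    have h := hinv (fun t => w (m + 1 + t))
    rw [hq₁symm] at h
    have e : m + 1 + (n - 1) = m + n := by omega
    simp only [e, hw, add_zero] at h
    rw [show (fun t : Fin (n - 1) => w (m + t.1 + 1)) = fun t => w (m + 1 + t.1) by
      funext t; congr 1; omega]
    exact h

lemma symm_all (hn : n = p + 2) (hq₁symm : ∀ x y : A, q₁ x y = q₁ y x)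
    (hinv : ∀ a : ℕ → A,
      q₁ (Γ (fun i : Fin (n - 1) => a i.1)) (a (n - 1)) =
        q₁ (a 0) (Γ (fun i : Fin (n - 1) => a (i.1 + 1))))
    (hqM : QSpec n p A Γ q₁ qM) (x y : Mspace p A) :
    qM x y = qM y x := by
  have e : qM = qM.flip := by
    apply hom_ext_tp
    intro i hi a
    apply hom_ext_tp
    intro j hj b
    rw [LinearMap.flip_apply]
    by_cases h0 : i + j = 0
    · rw [qM_1 hqM hn hi hj a b h0, qM_1 hqM hn hj hi b a (by omega), hq₁symm]
    by_cases h1 : i + j = p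
    · rw [qM_n hqM hn hi hj a b h1, qM_n hqM hn hj hi b a (by omega)]
      have h := cyc hn hq₁symm hinv
        (fun t => if t % n < i + 1 then a (t % n) else b (t % n - (i + 1)))
        (fun t => by simp) (i + 1)
      have m1 : (i + 1) % n = i + 1 := Nat.mod_eq_of_lt (by omega)
      simp only [Nat.zero_mod, m1, Nat.succ_pos, if_true, lt_irrefl, if_false,
        Nat.sub_self] at h
      refine Eq.trans ?_ (h.trans ?_)
      · congr 2
        funext t
        have := t.2
        rw [Nat.mod_eq_of_lt (show t.1 + 1 < n by omega)]
        split_ifs <;> first | omega | (congr 1 <;> omega)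
      · congr 2
        funext t
        have := t.2
        by_cases ht : t.1 < j
        · rw [Nat.mod_eq_of_lt (show i + 1 + t.1 + 1 < n by omega)]
          split_ifs <;> first | omega | (congr 1 <;> omega)
        · have : (i + 1 + t.1 + 1) % n = t.1 - j := by
            rw [show i + 1 + t.1 + 1 = (t.1 - j) + n by omega, Nat.add_mod_right,
              Nat.mod_eq_of_lt (by omega)]
          rw [this]
          split_ifs <;> first | omega | (congr 1 <;> omega)
    · rw [qM_0 hqM hi hj a b h0 h1, qM_0 hqM hj hi b a (by omega) (by omega)]
  exact LinearMap.congr_fun (LinearMap.congr_fun e x) y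

/-- vanishing of `q` between incompatible degrees -/
lemma q_vanish (hqM : QSpec n p A Γ q₁ qM) (i j : Fin p) (h : i.1 + j.1 ≠ 0)
    (h' : i.1 + j.1 ≠ p) (x : ⨂[ℂ]^(i.1 + 1) A) (y : ⨂[ℂ]^(j.1 + 1) A) :
    qM (incl p A i x) (incl p A j y) = 0 := by
  have ext1 : ∀ (N : Type) [AddCommGroup N] [Module ℂ N] (m : ℕ) (f : (⨂[ℂ]^m A) →ₗ[ℂ] N),
      (∀ a : ℕ → A, f (tp A m a) = 0) → f = 0 := by
    intro N _ _ m f hf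
    apply PiTensorProduct.ext
    ext a
    have := hf (fun i => if h : i < m then a ⟨i, h⟩ else 0)
    simpa [tp] using this
  have e1 : (qM.comp (incl p A i)).flip (incl p A j y) = 0 := by
    apply ext1
    intro a
    have e2 : (qM (incl p A i (tp A (i.1 + 1) a))).comp (incl p A j) = 0 := by
      apply ext1
      intro b
      exact qM_0 hqM i.2 j.2 a b h h'
    exact LinearMap.congr_fun e2 y
  exact LinearMap.congr_fun e1 x

lemma tensor_one (x : ⨂[ℂ]^(0 + 1) A) : ∃ v : A, x = tp A (0 + 1) (fun _ => v) := by
  refine ⟨PiTensorProduct.subsingletonEquiv (0 : Fin 1) x, ?_⟩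
  refine ((PiTensorProduct.subsingletonEquiv (R := ℂ) (s := fun _ : Fin 1 => A) (0 : Fin 1)).symm_apply_apply
    x).symm.trans ?_
  exact PiTensorProduct.subsingletonEquiv_symm_apply' (0 : Fin 1) _

lemma deg_one_zero (hn : n = p + 2) (hqM : QSpec n p A Γ q₁ qM)
    (hq₁nondeg : ∀ x : A, (∀ y : A, q₁ x y = 0) → x = 0) (hp : 0 < p)
    (x : ⨂[ℂ]^(0 + 1) A)
    (h : ∀ y : ⨂[ℂ]^(0 + 1) A, qM (incl p A ⟨0, hp⟩ x) (incl p A ⟨0, hp⟩ y) = 0) :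
    x = 0 := by
  obtain ⟨v, rfl⟩ := tensor_one x
  have : v = 0 := by
    apply hq₁nondeg
    intro y
    rw [← h (tp A (0 + 1) (fun _ => y)), qM_1 hqM hn hp hp _ _ rfl]
  subst this
  exact MultilinearMap.map_coord_zero _ (0 : Fin 1) rfl

lemma mul_deg_one (hmul : MulSpec n p A Γ mul) (k : Fin p) (hp : 0 < p)
    (x : ⨂[ℂ]^(k.1 + 1) A)
    (y : ⨂[ℂ]^(p - (k.1 + 1) + 1) A) :
    mul (incl p A k x) (incl p A ⟨p - (k.1 + 1), by have := k.isLt; omega⟩ y) ∈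
      LinearMap.range (incl p A ⟨0, hp⟩) := by
  have ext1 : ∀ (m : ℕ) (f : (⨂[ℂ]^m A) →ₗ[ℂ] Mspace p A),
      (∀ a : ℕ → A, f (tp A m a) ∈ LinearMap.range (incl p A ⟨0, hp⟩)) →
      ∀ x, f x ∈ LinearMap.range (incl p A ⟨0, hp⟩) := by
    intro m f hf x
    have : (LinearMap.range (incl p A ⟨0, hp⟩)).mkQ.comp f = 0 := by
      apply PiTensorProduct.ext
      ext a
      have := hf (fun i => if h : i < m then a ⟨i, h⟩ else 0)
      simpa [tp] using this
    have := LinearMap.congr_fun this x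
    simpa using this
  refine ext1 _ ((mul.comp (incl p A k)).flip (incl p A ⟨p - (k.1 + 1), _⟩ y)) ?_ x
  intro a
  refine ext1 _ ((mul (incl p A k (tp A (k.1 + 1) a))).comp
    (incl p A ⟨p - (k.1 + 1), by have := k.isLt; omega⟩)) ?_ y
  intro b
  have hk := k.2
  have e := mul_high hmul k.2 (show p - (k.1 + 1) < p by omega) a b (by omega)
  refine (show _ = _ from e) ▸ ?_
  have gen : ∀ (m : ℕ) (hm : m < p) (z : ⨂[ℂ]^(m + 1) A), m = 0 →
      incl p A ⟨m, hm⟩ z ∈ LinearMap.range (incl p A ⟨0, hp⟩) := by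
    rintro m hm z rfl
    exact ⟨z, rfl⟩
  exact gen _ _ _ (by omega)

lemma nondeg_all (hn : n = p + 2)
    (hq₁nondeg : ∀ x : A, (∀ y : A, q₁ x y = 0) → x = 0)
    (hI : ∀ x y z : Mspace p A, qM (mul x y) z = qM x (mul y z))
    (hmul : MulSpec n p A Γ mul) (hqM : QSpec n p A Γ q₁ qM) (x : Mspace p A)
    (hx : ∀ y, qM x y = 0) : x ∈ Isub p A mul := by
  classical
  have hsum : x = ∑ k : Fin p, incl p A k (x k) := by
    conv_lhs => rw [← DirectSum.sum_univ_of x]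
    rfl
  -- each component is in the radical
  have hcomp : ∀ (k : Fin p) (y : Mspace p A), qM (incl p A k (x k)) y = 0 := by
    intro k y
    have : qM (incl p A k (x k)) = 0 := by
      apply DirectSum.linearMap_ext
      intro l
      refine LinearMap.ext fun y => ?_
      show qM (incl p A k (x k)) (incl p A l y) = 0
      by_cases hc : k.1 + l.1 = 0 ∨ k.1 + l.1 = p
      · have h := hx (incl p A l y)
        rw [hsum, map_sum, LinearMap.sum_apply, Finset.sum_eq_single k] at h
        · exact h
        · intro k' _ hk'
          have : k'.1 ≠ k.1 := fun e => hk' (Fin.ext e)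
          have := k.2
          have := k'.2
          have := l.2
          exact q_vanish hqM _ _ (by omega) (by omega) _ _
        · simp
      · push Not at hc
        exact q_vanish hqM _ _ hc.1 hc.2 _ _
    rw [this]; rfl
  rw [hsum]
  apply Submodule.sum_mem
  intro k _
  refine Submodule.mem_iSup_of_mem k (Submodule.mem_map_of_mem ?_)
  have hp : 0 < p := lt_of_le_of_lt (Nat.zero_le _) k.2
  unfold Ik
  split_ifs with h0
  · rw [Submodule.mem_bot]
    have hk : k = ⟨0, hp⟩ := Fin.ext h0
    subst hk
    exact deg_one_zero hn hqM hq₁nondeg hp _ (fun y => hcomp _ _)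
  · rw [Submodule.mem_iInf]
    intro y
    rw [LinearMap.mem_ker]
    show mul (incl p A k (x k)) (incl p A ⟨p - (k.1 + 1), by have := k.isLt; omega⟩ y) = 0
    obtain ⟨z, hz⟩ := mul_deg_one hmul k hp (x k) y
    rw [← hz]
    rw [deg_one_zero hn hqM hq₁nondeg hp z, map_zero]
    intro c
    rw [hz, hI]
    exact hcomp _ _

end

/-- The bilinear form `q` on `M` is invariant with respect to the
multiplication: `q(a·b, c) = q(a, b·c)` for all `a, b, c ∈ M`; hence the induced form on
the quotient algebra `A = M/I` makes `A` a metrised algebra (the induced form is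
invariant, symmetric and nondegenerate). -/
theorem qM_invariant_and_quotient_metrised
    (n p : ℕ) (hn : 3 ≤ n) (hp : p = n - 2)
    (A : Type) [AddCommGroup A] [Module ℂ A] [FiniteDimensional ℂ A]
    (Γ : MultilinearMap ℂ (fun _ : Fin (n - 1) => A) A)
    (q₁ : A →ₗ[ℂ] A →ₗ[ℂ] ℂ)
    (hq₁symm : ∀ x y : A, q₁ x y = q₁ y x)
    (hq₁nondeg : ∀ x : A, (∀ y : A, q₁ x y = 0) → x = 0)
    (hinv : ∀ a : ℕ → A,
      q₁ (Γ (fun i : Fin (n - 1) => a i.1)) (a (n - 1)) =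
        q₁ (a 0) (Γ (fun i : Fin (n - 1) => a (i.1 + 1))))
    (hassoc : ∀ r s : ℕ, r ≤ n - 2 → s ≤ n - 2 → ∀ a : ℕ → A,
      gammaIns n A Γ r a = gammaIns n A Γ s a)
    (mul : Mspace p A →ₗ[ℂ] Mspace p A →ₗ[ℂ] Mspace p A)
    (hmul : MulSpec n p A Γ mul)
    (qM : Mspace p A →ₗ[ℂ] Mspace p A →ₗ[ℂ] ℂ)
    (hqM : QSpec n p A Γ q₁ qM)
    (mulQ : (Mspace p A ⧸ Isub p A mul) →ₗ[ℂ] (Mspace p A ⧸ Isub p A mul) →ₗ[ℂ]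
      (Mspace p A ⧸ Isub p A mul))
    (hmulQ : ∀ a b : Mspace p A,
      mulQ ((Isub p A mul).mkQ a) ((Isub p A mul).mkQ b) = (Isub p A mul).mkQ (mul a b))
    (qA : (Mspace p A ⧸ Isub p A mul) →ₗ[ℂ] (Mspace p A ⧸ Isub p A mul) →ₗ[ℂ] ℂ)
    (hqA : ∀ a b : Mspace p A,
      qA ((Isub p A mul).mkQ a) ((Isub p A mul).mkQ b) = qM a b) :
    (∀ a b c : Mspace p A, qM (mul a b) c = qM a (mul b c)) ∧
    (∀ x y z : Mspace p A ⧸ Isub p A mul, qA (mulQ x y) z = qA x (mulQ y z)) ∧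
    (∀ x y : Mspace p A ⧸ Isub p A mul, qA x y = qA y x) ∧
    (∀ x : Mspace p A ⧸ Isub p A mul,
      (∀ y : Mspace p A ⧸ Isub p A mul, qA x y = 0) → x = 0) := by
  have hn' : n = p + 2 := by omega
  have hI := inv_all hn' hinv hassoc hmul hqM
  refine ⟨hI, ?_, ?_, ?_⟩
  · intro x y z
    obtain ⟨x, rfl⟩ := Submodule.mkQ_surjective _ x
    obtain ⟨y, rfl⟩ := Submodule.mkQ_surjective _ y
    obtain ⟨z, rfl⟩ := Submodule.mkQ_surjective _ z
    rw [hmulQ, hmulQ, hqA, hqA, hI]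
  · intro x y
    obtain ⟨x, rfl⟩ := Submodule.mkQ_surjective _ x
    obtain ⟨y, rfl⟩ := Submodule.mkQ_surjective _ y
    rw [hqA, hqA, symm_all hn' hq₁symm hinv hqM]
  · intro x hx
    obtain ⟨x, rfl⟩ := Submodule.mkQ_surjective _ x
    rw [Submodule.mkQ_apply, Submodule.Quotient.mk_eq_zero]
    apply nondeg_all hn' hq₁nondeg hI hmul hqM
    intro y
    rw [← hqA]
    exact hx _
end
end

section
/- Let a, b ∈ I₁ ⊕ ⋯ ⊕ I_k satisfy θ(a) = ω a and θ(b) = ω b, and write a = a₁ + ⋯ + a_k, b = b₁ + ⋯ + b_k with a_j, b_j ∈ I_j. Then a_j = ω^{1−j} θ^{j−1}(a₁) for all j, and q(a, b) = k · q(a₁, b₁). -/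
theorem aux_step {n : ℕ} {A : Type} [AddCommGroup A] [Module ℂ A]
    (θ : A →ₗ[ℂ] A) (w : ℂ) (I : Fin (n+1) → Submodule ℂ A)
    (hcyc : ∀ j : Fin (n+1), Submodule.map θ (I j) = I (j + 1))
    (hindep : iSupIndep I) (a : A) (ha : θ a = w • a) (aj : Fin (n+1) → A)
    (haj : ∀ j, aj j ∈ I j) (hasum : a = ∑ j, aj j) (j : Fin (n+1)) :
    θ (aj j) = w • aj (j + 1) := by
  have hmem : ∀ j, θ (aj j) - w • aj (j + 1) ∈ I (j + 1) := by
    intro j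
    refine Submodule.sub_mem _ ?_ (Submodule.smul_mem _ _ (haj _))
    rw [← hcyc]
    exact Submodule.mem_map_of_mem (haj j)
  have hshift : ∑ j, aj (j + 1) = ∑ j, aj j :=
    Equiv.sum_comp (Equiv.addRight (1 : Fin (n+1))) aj
  have hsum : ∑ j, (θ (aj j) - w • aj (j + 1)) = 0 := by
    rw [Finset.sum_sub_distrib, ← map_sum, ← Finset.smul_sum,
      hshift, ← hasum, ha, sub_self]
  have hind : iSupIndep (fun j : Fin (n+1) => I (j + 1)) :=
    hindep.comp (add_left_injective 1)
  have := (iSupIndep_iff_finsetSum_eq_zero_imp_eq_zero _).1 hind Finset.univ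
    (fun j => θ (aj j) - w • aj (j + 1)) (fun i _ => hmem i) hsum j (Finset.mem_univ j)
  exact sub_eq_zero.1 this

/-- Let `θ` satisfy `θ^p = id` and `q(θx, θy) = ω² q(x, y)`, and let
`I₁, …, I_k` be pairwise `q`-orthogonal subspaces, cyclically permuted by `θ`, whose sum
is direct.  If `a, b ∈ I₁ ⊕ ⋯ ⊕ I_k` satisfy `θ(a) = ω a`, `θ(b) = ω b`, with components
`a_j, b_j ∈ I_j`, then `a_j = ω^{1−j} θ^{j−1}(a₁)` for all `j`, and
`q(a, b) = k · q(a₁, b₁)`.  (Indices are 0-based here: `a_j = ω^{-j} θ^j(a₀)`.) -/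
theorem components_of_omega_eigenvector_and_pairing
    (p : ℕ) (hp : 1 ≤ p)
    (A : Type) [AddCommGroup A] [Module ℂ A] [FiniteDimensional ℂ A]
    (q : A →ₗ[ℂ] A →ₗ[ℂ] ℂ)
    (hsymm : ∀ x y : A, q x y = q y x)
    (θ : A →ₗ[ℂ] A)
    (hθp : θ ^ p = LinearMap.id)
    (hθq : ∀ x y : A,
      q (θ x) (θ y) = Complex.exp (2 * Real.pi * Complex.I / p) ^ 2 * q x y)
    (k : ℕ) (hk : 1 ≤ k)
    (I : Fin k → Submodule ℂ A)
    (horth : ∀ i j : Fin k, i ≠ j → ∀ x ∈ I i, ∀ y ∈ I j, q x y = 0)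
    (hcyc : ∀ j : Fin k, Submodule.map θ (I j) = I (j + ⟨1 % k, Nat.mod_lt 1 hk⟩))
    (hindep : iSupIndep I)
    (a b : A)
    (ha : θ a = Complex.exp (2 * Real.pi * Complex.I / p) • a)
    (hb : θ b = Complex.exp (2 * Real.pi * Complex.I / p) • b)
    (aj bj : Fin k → A)
    (haj : ∀ j : Fin k, aj j ∈ I j) (hbj : ∀ j : Fin k, bj j ∈ I j)
    (hasum : a = ∑ j : Fin k, aj j) (hbsum : b = ∑ j : Fin k, bj j) :
    (∀ j : Fin k,
      aj j = (Complex.exp (2 * Real.pi * Complex.I / p) ^ (j : ℕ))⁻¹ • (θ ^ (j : ℕ)) (aj ⟨0, hk⟩)) ∧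
    q a b = (k : ℂ) * q (aj ⟨0, hk⟩) (bj ⟨0, hk⟩) := by
  obtain ⟨n, rfl⟩ : ∃ n, k = n + 1 := ⟨k - 1, by omega⟩
  have hw : Complex.exp (2 * Real.pi * Complex.I / p) ≠ 0 := Complex.exp_ne_zero _
  generalize Complex.exp (2 * Real.pi * Complex.I / p) = w at *
  have hcyc' : ∀ j : Fin (n+1), Submodule.map θ (I j) = I (j + 1) := hcyc
  have hA := aux_step θ w I hcyc' hindep a ha aj haj hasum
  have hB := aux_step θ w I hcyc' hindep b hb bj hbj hbsum
  have h0 : (⟨0, hk⟩ : Fin (n+1)) = 0 := rfl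
  rw [h0]
  refine ⟨?_, ?_⟩
  · intro j
    rw [eq_inv_smul_iff₀ (pow_ne_zero _ hw)]
    induction j using Fin.induction with
    | zero => simp
    | succ i ih =>
      have h := hA i.castSucc
      rw [Fin.coeSucc_eq_succ] at h
      simp only [Fin.val_castSucc] at ih
      rw [Fin.val_succ, pow_succ, mul_smul, ← h, pow_succ', Module.End.mul_apply, ← ih, map_smul]
  · have hq : ∀ j, q (aj j) (bj j) = q (aj 0) (bj 0) := by
      intro j
      induction j using Fin.induction with
      | zero => rfl
      | succ i ih =>
        have h := hθq (aj i.castSucc) (bj i.castSucc)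
        rw [hA, hB, Fin.coeSucc_eq_succ, ih] at h
        simp only [map_smul, LinearMap.smul_apply, smul_eq_mul] at h
        apply mul_left_cancel₀ (pow_ne_zero 2 hw)
        rw [← h]; ring
    have hrow : ∀ i, q (aj i) (∑ j, bj j) = q (aj 0) (bj 0) := by
      intro i
      rw [map_sum, Finset.sum_eq_single i, hq]
      · intro j _ hj
        exact horth i j hj.symm _ (haj i) _ (hbj j)
      · simp
    rw [hasum, hbsum, map_sum q, LinearMap.sum_apply, Finset.sum_congr rfl (fun i _ => hrow i)]
    simp
end
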